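/- Let T be a decision tree over a finite feature set F in which no feature labels two distinct inner nodes on the same root-to-leaf path, let c ∈ Bool, and let τ : F' → Bool be a partial example (F' ⊆ F). Say a leaf l of T is consistent with τ if α_T^l(f) = τ(f) for every f ∈ F' on which α_T^l is defined. Then: (1) τ is a global abductive explanation for the class c w.r.t. the model computed by T if and only if every leaf of T consistent with τ has label c; (2) τ is a global contrastive explanation for the class c w.r.t. the model computed by T if and only if no leaf of T consistent with τ has label c. -/

import Mathlib

/-- A decision tree over feature set `F`. -/
inductive DTree (F : Type*) where
  | leaf : Bool → DTree F
  | node : F → DTree F → DTree F → DTree F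

namespace DTree

/-- Classification of an example by a decision tree. -/
def eval {F : Type*} : DTree F → (F → Bool) → Bool
  | leaf b, _ => b
  | node f t0 t1, e => if e f then t1.eval e else t0.eval e

/-- The list of features occurring at inner nodes of a decision tree. -/
def features {F : Type*} : DTree F → List F
  | leaf _ => []
  | node f t0 t1 => f :: (t0.features ++ t1.features)

/-- The leaves of a decision tree, each together with its path assignment `α_T^l`
(the list of (feature, value) pairs along the root-to-leaf path) and its label. -/
def leavesWithPath {F : Type*} : DTree F → List (List (F × Bool) × Bool)
  | leaf b => [([], b)]
  | node f t0 t1 =>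
      (t0.leavesWithPath.map fun pb => ((f, false) :: pb.1, pb.2)) ++
      (t1.leavesWithPath.map fun pb => ((f, true) :: pb.1, pb.2))

/-- No feature labels two distinct inner nodes on the same root-to-leaf path. -/
def NonRedundant {F : Type*} : DTree F → Prop
  | leaf _ => True
  | node f t0 t1 =>
      f ∉ t0.features ∧ f ∉ t1.features ∧ t0.NonRedundant ∧ t1.NonRedundant

end DTree

/-- The partial example with domain `dom` and values `τ` is a global abductive
explanation (gAXp) for class `c` w.r.t. model `M`. -/
def IsGAXp {F : Type*} (M : (F → Bool) → Bool) (dom : Set F) (τ : F → Bool) (c : Bool) : Prop :=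
  ∀ e : F → Bool, (∀ f ∈ dom, e f = τ f) → M e = c

/-- The partial example with domain `dom` and values `τ` is a global contrastive
explanation (gCXp) for class `c` w.r.t. model `M`. -/
def IsGCXp {F : Type*} (M : (F → Bool) → Bool) (dom : Set F) (τ : F → Bool) (c : Bool) : Prop :=
  ∀ e : F → Bool, (∀ f ∈ dom, e f = τ f) → M e ≠ c

/-- A leaf with path assignment `p` is consistent with the partial example `(dom, τ)`. -/
def LeafConsistent {F : Type*} (dom : Set F) (τ : F → Bool) (p : List (F × Bool)) : Prop :=
  ∀ fb ∈ p, fb.1 ∈ dom → fb.2 = τ fb.1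

namespace DTree

variable {F : Type*}

/-- Every example reaches a leaf, whose path it follows. -/
theorem exists_leaf_of_example (T : DTree F) (e : F → Bool) :
    ∃ p, (p, T.eval e) ∈ T.leavesWithPath ∧ ∀ fb ∈ p, e fb.1 = fb.2 := by
  induction T with
  | leaf b => exact ⟨[], by simp [leavesWithPath, eval]⟩
  | node f t0 t1 ih0 ih1 =>
    obtain ⟨p0, h0, a0⟩ := ih0
    obtain ⟨p1, h1, a1⟩ := ih1
    cases hf : e f with
    | false =>
      refine ⟨(f, false) :: p0, ?_, List.forall_mem_cons.2 ⟨hf, a0⟩⟩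
      simpa [leavesWithPath, eval, hf] using h0
    | true =>
      refine ⟨(f, true) :: p1, ?_, List.forall_mem_cons.2 ⟨hf, a1⟩⟩
      simpa [leavesWithPath, eval, hf] using h1

theorem mem_leavesWithPath_node {f : F} {t0 t1 : DTree F} {p : List (F × Bool)} {b : Bool} :
    (p, b) ∈ (node f t0 t1).leavesWithPath ↔
      ∃ v q, p = (f, v) :: q ∧ (q, b) ∈ (if v then t1 else t0).leavesWithPath := by
  simp only [leavesWithPath, List.mem_append, List.mem_map, Prod.mk.injEq, Prod.exists,
    Bool.exists_bool]
  cases b <;> grind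

/-- An example following the path of a leaf is classified by that leaf. -/
theorem eval_eq_of_mem_leavesWithPath {T : DTree F} {e : F → Bool} {p : List (F × Bool)}
    {b : Bool} (h : (p, b) ∈ T.leavesWithPath) (he : ∀ fb ∈ p, e fb.1 = fb.2) :
    T.eval e = b := by
  induction T generalizing p with
  | leaf => simp_all [leavesWithPath, eval]
  | node f t0 t1 ih0 ih1 =>
    obtain ⟨v, q, rfl, hq⟩ := mem_leavesWithPath_node.1 h
    obtain ⟨hf, heq⟩ := List.forall_mem_cons.1 he
    cases v
    · simpa [eval, hf] using ih0 hq heq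
    · simpa [eval, hf] using ih1 hq heq

theorem mem_features_of_mem_path {T : DTree F} {p : List (F × Bool)} {b : Bool}
    (h : (p, b) ∈ T.leavesWithPath) : ∀ fb ∈ p, fb.1 ∈ T.features := by
  induction T generalizing p with
  | leaf => simp_all [leavesWithPath]
  | node f t0 t1 ih0 ih1 =>
    obtain ⟨v, q, rfl, hq⟩ := mem_leavesWithPath_node.1 h
    cases v <;> grind [features]

/-- A leaf consistent with a partial example is reached by an example agreeing with it. -/
theorem exists_example_of_leafConsistent {T : DTree F} (hT : T.NonRedundant) {dom : Set F}
    {τ : F → Bool} {p : List (F × Bool)} {b : Bool} (h : (p, b) ∈ T.leavesWithPath)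
    (hp : LeafConsistent dom τ p) :
    ∃ e : F → Bool, (∀ f ∈ dom, e f = τ f) ∧ ∀ fb ∈ p, e fb.1 = fb.2 := by
  classical
  induction T generalizing p with
  | leaf => exact ⟨τ, by simp_all [leavesWithPath]⟩
  | node f t0 t1 ih0 ih1 =>
    obtain ⟨v, q, rfl, hq⟩ := mem_leavesWithPath_node.1 h
    obtain ⟨hf, hc⟩ := List.forall_mem_cons.1 hp
    obtain ⟨n0, n1, r0, r1⟩ := hT
    have hfq : ∀ fb ∈ q, fb.1 ≠ f := by
      intro fb hfb hfe
      have := mem_features_of_mem_path hq fb hfb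
      cases v <;> simp_all
    have ih : ∃ e : F → Bool, (∀ f ∈ dom, e f = τ f) ∧ ∀ fb ∈ q, e fb.1 = fb.2 := by
      cases v
      · exact ih0 r0 hq hc
      · exact ih1 r1 hq hc
    obtain ⟨e, he, heq⟩ := ih
    refine ⟨Function.update e f v, fun g hg => ?_, List.forall_mem_cons.2 ⟨by simp, ?_⟩⟩
    · by_cases hgf : g = f
      · subst hgf
        simpa using hf hg
      · simpa [hgf] using he g hg
    · intro fb hfb
      simpa [hfq fb hfb] using heq fb hfb

/-- The labels of the consistent leaves are the classes of the examples agreeing with `τ`. -/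
theorem forall_example_iff_forall_leaf {T : DTree F} (hT : T.NonRedundant) (dom : Set F)
    (τ : F → Bool) (P : Bool → Prop) :
    (∀ e : F → Bool, (∀ f ∈ dom, e f = τ f) → P (T.eval e)) ↔
      ∀ p : List (F × Bool), ∀ b : Bool, (p, b) ∈ T.leavesWithPath →
        LeafConsistent dom τ p → P b := by
  constructor
  · intro h p b hb hp
    obtain ⟨e, he, hep⟩ := exists_example_of_leafConsistent hT hb hp
    exact eval_eq_of_mem_leavesWithPath hb hep ▸ h e he
  · intro h e he
    obtain ⟨p, hp, hep⟩ := T.exists_leaf_of_example e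
    exact h p _ hp fun fb hfb hd => (hep fb hfb).symm.trans (he _ hd)

end DTree

theorem stmt13 (F : Type*) (T : DTree F) (hT : T.NonRedundant) (c : Bool)
    (dom : Set F) (τ : F → Bool) :
    (IsGAXp T.eval dom τ c ↔
      ∀ p : List (F × Bool), ∀ b : Bool, (p, b) ∈ T.leavesWithPath →
        LeafConsistent dom τ p → b = c) ∧
    (IsGCXp T.eval dom τ c ↔
      ∀ p : List (F × Bool), ∀ b : Bool, (p, b) ∈ T.leavesWithPath →
        LeafConsistent dom τ p → b ≠ c) := by
  exact ⟨DTree.forall_example_iff_forall_leaf hT dom τ (· = c),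
    DTree.forall_example_iff_forall_leaf hT dom τ (· ≠ c)⟩
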